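/- arXiv:1503.01809 — 8 statements merged into one kernel-verified Lean document; each statement's English description precedes it below -/
import Mathlib

section
/- Let f : ℝⁿ → ℝⁿ be strictly differentiable at every point (i.e., for every x there is a linear map f'(x) which is a strict (Hadamard) derivative of f at x). Assume: (b1) for every y ∈ ℝⁿ the functional φ(x) = (1/2)‖f(x) − y‖² is coercive, i.e., φ(x) → ∞ as ‖x‖ → ∞; and (b2) det f'(x) ≠ 0 for every x ∈ ℝⁿ. Then f is a global diffeomorphism of ℝⁿ onto ℝⁿ: f is bijective and both f and its inverse f⁻¹ are differentiable at every point. -/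
open Filter

/-- Main theorem (Theorem 3 of the paper): a strictly differentiable map
`f : ℝⁿ → ℝⁿ` such that (b1) `x ↦ ½‖f x − y‖²` is coercive for every `y` and
(b2) `det f'(x) ≠ 0` for every `x`, is a global diffeomorphism. -/
theorem global_diffeomorphism_of_strict
    (n : ℕ)
    (f : EuclideanSpace ℝ (Fin n) → EuclideanSpace ℝ (Fin n))
    (f' : EuclideanSpace ℝ (Fin n) →
      (EuclideanSpace ℝ (Fin n) →L[ℝ] EuclideanSpace ℝ (Fin n)))
    (hf : ∀ x, HasStrictFDerivAt f (f' x) x)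
    (hb1 : ∀ y : EuclideanSpace ℝ (Fin n),
      Tendsto (fun x => (1 / 2 : ℝ) * ‖f x - y‖ ^ 2)
        (Filter.comap (fun x => ‖x‖) atTop) atTop)
    (hb2 : ∀ x, LinearMap.det ((f' x).toLinearMap) ≠ 0) :
    Function.Bijective f ∧ Differentiable ℝ f ∧
      Differentiable ℝ (Function.invFun f) := by
  have hdet : ∀ x, (f' x).det ≠ 0 := hb2
  have he : ∀ x, HasStrictFDerivAt f
      (((f' x).toContinuousLinearEquivOfDetNeZero (hdet x) :
        EuclideanSpace ℝ (Fin n) ≃L[ℝ] EuclideanSpace ℝ (Fin n)) :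
        EuclideanSpace ℝ (Fin n) →L[ℝ] EuclideanSpace ℝ (Fin n)) x := by
    intro x
    rw [ContinuousLinearMap.coe_toContinuousLinearEquivOfDetNeZero]
    exact hf x
  have hdiff : Differentiable ℝ f := fun x => (hf x).differentiableAt
  have hcont : Continuous f := hdiff.continuous
  have hloc : IsLocalHomeomorph f := fun x =>
    ⟨(he x).toOpenPartialHomeomorph f, (he x).mem_toOpenPartialHomeomorph_source, rfl⟩
  have hnorm : Tendsto (fun x => ‖f x‖) (cocompact (EuclideanSpace ℝ (Fin n))) atTop := by
    have h0 := hb1 0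
    rw [comap_norm_atTop, Metric.cobounded_eq_cocompact] at h0
    rw [tendsto_atTop] at h0 ⊢
    intro b
    filter_upwards [h0 ((1 / 2 : ℝ) * b ^ 2)] with x hx
    rw [sub_zero] at hx
    exact le_of_sq_le_sq (by linarith) (norm_nonneg _)
  have hproper : IsProperMap f := by
    rw [isProperMap_iff_tendsto_cocompact]
    refine ⟨hcont, ?_⟩
    rw [← Metric.cobounded_eq_cocompact (α := EuclideanSpace ℝ (Fin n)),
      ← tendsto_norm_atTop_iff_cobounded, Metric.cobounded_eq_cocompact]
    exact hnorm
  have hcov : IsCoveringMap f := by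
    rw [isCoveringMap_iff_isCoveringMapOn_univ]
    refine hproper.isClosedMap.isCoveringMapOn_of_isLocalHomeomorphOn (fun y _ => ?_)
      (fun x _ => hloc x)
    refine (hproper.isCompact_preimage isCompact_singleton).finite
      (.of_openPartialHomeomorph f subset_rfl fun x _ => ?_)
    exact ⟨(he x).toOpenPartialHomeomorph f, (he x).mem_toOpenPartialHomeomorph_source, rfl⟩
  have hlift := fun a => (hcov.existsUnique_continuousMap_lifts
    (ContinuousMap.id (EuclideanSpace ℝ (Fin n))) (f a) a rfl).exists
  have hinj : Function.Injective f := by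
    intro a b hab
    obtain ⟨F, hFa, hF⟩ := hlift a
    have h : F ∘ f = id := hcov.eq_of_comp_eq (F.continuous.comp hcont) continuous_id
      (by rw [← Function.comp_assoc, hF]; rfl) a hFa
    have hb : F (f b) = b := congrFun h b
    rw [← hb, ← hab, hFa]
  have hsurj : Function.Surjective f := by
    intro y
    obtain ⟨F, -, hF⟩ := hlift 0
    exact ⟨F y, congrFun hF y⟩
  refine ⟨⟨hinj, hsurj⟩, hdiff, fun y => ?_⟩
  obtain ⟨x, rfl⟩ := hsurj y
  exact ((he x).to_local_left_inverse
    (Eventually.of_forall (Function.leftInverse_invFun hinj))).differentiableAt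
end

section
/- Let f : ℝⁿ → ℝⁿ be strictly differentiable at every point with derivative f'(x) at x. Assume that for every y ∈ ℝⁿ the functional x ↦ (1/2)‖f(x) − y‖² is coercive, and that det f'(x) ≠ 0 for every x ∈ ℝⁿ. Then f is surjective: for every y ∈ ℝⁿ there exists x̄ ∈ ℝⁿ with f(x̄) = y. -/
open Filter

/-- Surjectivity part of the main theorem: under (b1) and (b2), `f` is onto. -/
theorem surjective_of_strict
    (n : ℕ)
    (f : EuclideanSpace ℝ (Fin n) → EuclideanSpace ℝ (Fin n))
    (f' : EuclideanSpace ℝ (Fin n) →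
      (EuclideanSpace ℝ (Fin n) →L[ℝ] EuclideanSpace ℝ (Fin n)))
    (hf : ∀ x, HasStrictFDerivAt f (f' x) x)
    (hb1 : ∀ y : EuclideanSpace ℝ (Fin n),
      Tendsto (fun x => (1 / 2 : ℝ) * ‖f x - y‖ ^ 2)
        (Filter.comap (fun x => ‖x‖) atTop) atTop)
    (hb2 : ∀ x, LinearMap.det ((f' x).toLinearMap) ≠ 0) :
    ∀ y : EuclideanSpace ℝ (Fin n), ∃ xbar, f xbar = y := by
  intro y
  have hc : Continuous f := continuous_iff_continuousAt.2 fun x => (hf x).continuousAt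
  have hcc : Continuous (fun x => (1 / 2 : ℝ) * ‖f x - y‖ ^ 2) := by fun_prop
  have hlim := hb1 y
  rw [comap_norm_atTop, Metric.cobounded_eq_cocompact] at hlim
  obtain ⟨x, hx⟩ := hcc.exists_forall_le hlim
  refine ⟨x, ?_⟩
  by_contra hne
  have hpos : 0 < ‖f x - y‖ := norm_pos_iff.2 (sub_ne_zero.2 hne)
  have hmap : map f (nhds x) = nhds (f x) := by
    apply (hf x).map_nhds_eq_of_surj
    exact LinearMap.range_eq_top.2
      (LinearMap.equivOfDetNeZero (f' x).toLinearMap (hb2 x)).surjective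
  have hev : ∀ᶠ z in nhds (f x), (1 / 2 : ℝ) * ‖f x - y‖ ^ 2 ≤ (1 / 2 : ℝ) * ‖z - y‖ ^ 2 := by
    rw [← hmap, eventually_map]
    exact Filter.Eventually.of_forall hx
  have ht : Tendsto (fun t : ℝ => f x - t • (f x - y)) (nhds 0) (nhds (f x)) := by
    have h : Continuous (fun t : ℝ => f x - t • (f x - y)) := by fun_prop
    simpa using h.tendsto 0
  obtain ⟨t, h1, h0, h2⟩ := (((ht.eventually hev).filter_mono nhdsWithin_le_nhds).and
    (Ioo_mem_nhdsGT (show (0 : ℝ) < 1 by norm_num))).exists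
  have he : f x - t • (f x - y) - y = (1 - t) • (f x - y) := by module
  rw [he, norm_smul, Real.norm_of_nonneg (by linarith), mul_pow] at h1
  have h3 : (1 - t) ^ 2 < 1 := by nlinarith
  nlinarith [pow_pos hpos 2]
end

section
/- Let f : ℝⁿ → ℝⁿ be strictly differentiable at every point with derivative f'(x) at x. Assume that for every y ∈ ℝⁿ the functional x ↦ (1/2)‖f(x) − y‖² is coercive, and that det f'(x) ≠ 0 for every x ∈ ℝⁿ. Then f is injective: if f(x₁) = f(x₂) then x₁ = x₂. -/
open Filter

/-- Injectivity part of the main theorem: under (b1) and (b2), `f` is one-to-one. -/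
theorem injective_of_strict
    (n : ℕ)
    (f : EuclideanSpace ℝ (Fin n) → EuclideanSpace ℝ (Fin n))
    (f' : EuclideanSpace ℝ (Fin n) →
      (EuclideanSpace ℝ (Fin n) →L[ℝ] EuclideanSpace ℝ (Fin n)))
    (hf : ∀ x, HasStrictFDerivAt f (f' x) x)
    (hb1 : ∀ y : EuclideanSpace ℝ (Fin n),
      Tendsto (fun x => (1 / 2 : ℝ) * ‖f x - y‖ ^ 2)
        (Filter.comap (fun x => ‖x‖) atTop) atTop)
    (hb2 : ∀ x, LinearMap.det ((f' x).toLinearMap) ≠ 0) :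
    ∀ x₁ x₂ : EuclideanSpace ℝ (Fin n), f x₁ = f x₂ → x₁ = x₂ := by
  intro x₁ x₂ h12
  have hcont : Continuous f :=
    continuous_iff_continuousAt.2 fun x => (hf x).hasFDerivAt.continuousAt
  -- `f` is proper, by coercivity
  have hproper : IsProperMap f := by
    refine isProperMap_iff_tendsto_cocompact.mpr ⟨hcont, ?_⟩
    rw [← Metric.cobounded_eq_cocompact, ← tendsto_norm_atTop_iff_cobounded]
    have h0 := hb1 0
    rw [comap_norm_atTop] at h0
    refine tendsto_atTop.2 fun r => ?_
    filter_upwards [h0.eventually_ge_atTop (1 / 2 * r ^ 2)] with x hx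
    simp only [sub_zero] at hx
    exact (le_abs_self r).trans (abs_le_of_sq_le_sq (by linarith) (norm_nonneg _))
  -- `f` is a local homeomorphism, by the inverse function theorem
  have hloc : ∀ x, ∃ φ : OpenPartialHomeomorph (EuclideanSpace ℝ (Fin n))
      (EuclideanSpace ℝ (Fin n)), x ∈ φ.source ∧ φ = f := by
    intro x
    have hx : HasStrictFDerivAt f
        (((f' x).toContinuousLinearEquivOfDetNeZero (hb2 x) :
          EuclideanSpace ℝ (Fin n) ≃L[ℝ] EuclideanSpace ℝ (Fin n)) :
          EuclideanSpace ℝ (Fin n) →L[ℝ] EuclideanSpace ℝ (Fin n)) x := by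
      rw [ContinuousLinearMap.coe_toContinuousLinearEquivOfDetNeZero]
      exact hf x
    exact ⟨hx.toOpenPartialHomeomorph f, hx.mem_toOpenPartialHomeomorph_source,
      hx.toOpenPartialHomeomorph_coe⟩
  have hcov : IsCoveringMap f := fun y =>
    hproper.isClosedMap.isEvenlyCovered_of_openPartialHomeomorph
      ((hproper.isCompact_preimage isCompact_singleton).finite
        (.of_openPartialHomeomorph f subset_rfl fun e _ => hloc e)) fun e _ => hloc e
  -- lift the identity through `f`
  obtain ⟨F, ⟨hF1, hF2⟩, -⟩ := hcov.existsUnique_continuousMap_lifts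
    (ContinuousMap.id (EuclideanSpace ℝ (Fin n))) (f x₁) x₁ rfl
  have hG : F ∘ f = id := by
    refine hcov.eq_of_comp_eq (F.continuous.comp hcont) continuous_id ?_ x₁ hF1
    funext x
    exact congrFun hF2 (f x)
  have e1 := congrFun hG x₁
  have e2 := congrFun hG x₂
  simp only [Function.comp, id] at e1 e2
  rw [← e1, ← e2, h12]
end

section
/- Let X and B be finite-dimensional Euclidean spaces and let f : X → B be a C¹-mapping such that (a1) the derivative f'(x) is an invertible linear map for every x ∈ X, and (a2) ‖f(x)‖ → ∞ as ‖x‖ → ∞. Then f is a global diffeomorphism: f is bijective and both f and its inverse f⁻¹ are differentiable at every point. -/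
open Filter

/-- Katriel's theorem (Theorem 1 of the paper): a `C¹` map between
finite-dimensional Euclidean spaces with everywhere invertible derivative
and `‖f x‖ → ∞` as `‖x‖ → ∞` is a global diffeomorphism. -/
theorem katriel_global_diffeomorphism
    {X B : Type*}
    [NormedAddCommGroup X] [InnerProductSpace ℝ X] [FiniteDimensional ℝ X]
    [NormedAddCommGroup B] [InnerProductSpace ℝ B] [FiniteDimensional ℝ B]
    (f : X → B)
    (hC1 : ContDiff ℝ 1 f)
    (ha1 : ∀ x : X, Function.Bijective (fderiv ℝ f x))
    (ha2 : Tendsto (fun x => ‖f x‖) (Filter.comap (fun x : X => ‖x‖) atTop) atTop) :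
    Function.Bijective f ∧ Differentiable ℝ f ∧
      Differentiable ℝ (Function.invFun f) := by
  have hdiff : Differentiable ℝ f := hC1.differentiable (by norm_num)
  have hcont : Continuous f := hC1.continuous
  have hstrict : ∀ x, ∃ f' : X ≃L[ℝ] B, HasStrictFDerivAt f (f' : X →L[ℝ] B) x := by
    intro x
    refine ⟨(LinearEquiv.ofBijective (fderiv ℝ f x : X →ₗ[ℝ] B)
      (ha1 x)).toContinuousLinearEquiv, ?_⟩
    have h := hC1.contDiffAt.hasStrictFDerivAt (x := x) (by norm_num)
    convert h using 1
    ext v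
    rfl
  have hloc : IsLocalHomeomorph f := by
    apply IsLocalHomeomorph.mk
    intro x
    obtain ⟨f', hf'⟩ := hstrict x
    exact ⟨hf'.toOpenPartialHomeomorph f, hf'.mem_toOpenPartialHomeomorph_source,
      fun y _ => rfl⟩
  have hproper : IsProperMap f := by
    rw [isProperMap_iff_tendsto_cocompact]
    refine ⟨hcont, ?_⟩
    rw [← Metric.cobounded_eq_cocompact, ← Metric.cobounded_eq_cocompact,
      ← comap_norm_atTop, ← comap_norm_atTop, tendsto_comap_iff]
    exact ha2
  have hcov : IsCoveringMap f := by
    rw [isCoveringMap_iff_isCoveringMapOn_univ]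
    refine hproper.isClosedMap.isCoveringMapOn_of_isLocalHomeomorphOn (fun b _ => ?_)
      hloc.isLocalHomeomorphOn
    refine (hproper.isCompact_preimage isCompact_singleton).finite
      (IsDiscrete.of_openPartialHomeomorph f (x := b) subset_rfl fun e _ => ?_)
    obtain ⟨φ, h1, h2⟩ := hloc e
    exact ⟨φ, h1, h2.symm⟩
  have : SimplyConnectedSpace B := inferInstance
  obtain ⟨F, ⟨hF0, hF⟩, -⟩ := hcov.existsUnique_continuousMap_lifts (ContinuousMap.id B)
    (f 0) 0 rfl
  have hright : ∀ b, f (F b) = b := fun b => congrFun hF b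
  have hleft : ∀ x, F (f x) = x := by
    have h := hcov.eq_of_comp_eq (g₁ := fun x => F (f x)) (g₂ := id)
      (F.continuous.comp hcont) continuous_id (by ext x; simp [hright]) 0 hF0
    exact fun x => congrFun h x
  have hbij : Function.Bijective f :=
    ⟨Function.LeftInverse.injective hleft, Function.RightInverse.surjective hright⟩
  have hinv : Function.invFun f = F := by
    funext b
    apply hbij.1
    rw [hright, Function.rightInverse_invFun hbij.2 b]
  refine ⟨hbij, hdiff, ?_⟩
  rw [hinv]
  intro b
  obtain ⟨f', hf'⟩ := hstrict (F b)
  exact (HasFDerivAt.of_local_left_inverse F.continuous.continuousAt hf'.hasFDerivAt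
    (Eventually.of_forall hright)).differentiableAt
end

section
/- Let D be an open subset of ℝⁿ and let f : D → ℝⁿ be Fréchet differentiable at every point of D with det f'(x) ≠ 0 for every x ∈ D. Then f is a local diffeomorphism: every point x₀ ∈ D has an open neighborhood U ⊆ D such that f restricted to U is injective, f(U) is open, and the inverse map f(U) → U is differentiable. -/
open Set Filter Topology Metric

section Helpers

variable {E : Type*} [NormedAddCommGroup E] [InnerProductSpace ℝ E] [FiniteDimensional ℝ E]

/-- quantitative first-order approximation at a point with invertible derivative -/
lemma ldet_approx {f : E → E} {A : E ≃L[ℝ] E} {x : E} (h : HasFDerivAt f (A : E →L[ℝ] E) x) :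
    ∃ c > 0, ∃ r > 0, ∀ w, dist w x < r →
      c * ‖w - x‖ ≤ ‖f w - f x‖ ∧ ‖f w - f x - A (w - x)‖ ≤ c / 4 * ‖w - x‖ := by
  obtain ⟨C, hC, hA⟩ : ∃ C : ℝ, 0 < C ∧ ∀ v, ‖v‖ ≤ C * ‖A v‖ := by
    refine ⟨‖(A.symm : E →L[ℝ] E)‖ + 1, by positivity, fun v => ?_⟩
    have := (A.symm : E →L[ℝ] E).le_opNorm (A v)
    simp only [ContinuousLinearEquiv.coe_coe, ContinuousLinearEquiv.symm_apply_apply] at this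
    nlinarith [norm_nonneg (A v)]
  set c : ℝ := 1 / (2 * C) with hc
  have hcp : 0 < c := by positivity
  have hlit := h.isLittleO
  have := hlit.def (show 0 < c / 4 by positivity)
  obtain ⟨r, hr, hball⟩ := Metric.eventually_nhds_iff.1 this
  refine ⟨c, hcp, r, hr, fun w hw => ?_⟩
  have h2 := hball hw
  simp only [ContinuousLinearEquiv.coe_coe] at h2
  refine ⟨?_, h2⟩
  have h3 := hA (w - x)
  have h4 : ‖A (w - x)‖ ≤ ‖f w - f x‖ + ‖f w - f x - A (w - x)‖ := by
    have := norm_sub_le (f w - f x) (f w - f x - A (w - x))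
    simpa using this
  have h5 : 2 * c * ‖w - x‖ ≤ ‖A (w - x)‖ := by
    have : 2 * c * C = 1 := by rw [hc]; field_simp
    calc 2 * c * ‖w - x‖ ≤ 2 * c * (C * ‖A (w - x)‖) := by gcongr
      _ = (2 * c * C) * ‖A (w - x)‖ := by ring
      _ = _ := by rw [this, one_mul]
  have := norm_nonneg (w - x)
  nlinarith

/-- openness at a point, by minimizing the distance -/
lemma ldet_open {D : Set E} (hD : IsOpen D) {f : E → E} {A : E → (E ≃L[ℝ] E)}
    (hf : ∀ x ∈ D, HasFDerivAt f (A x : E →L[ℝ] E) x) {x : E} (hx : x ∈ D) {W : Set E}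
    (hW : W ∈ 𝓝 x) : f '' W ∈ 𝓝 (f x) := by
  obtain ⟨c, hc, r, hr, hcr⟩ := ldet_approx (hf x hx)
  obtain ⟨r', hr', hsub⟩ := Metric.mem_nhds_iff.1 (inter_mem hW (hD.mem_nhds hx))
  set s := min r r' / 2 with hs
  have hs0 : 0 < s := by positivity
  have hsr : s < r := by have := min_le_left r r'; linarith
  have hsr' : s < r' := by have := min_le_right r r'; linarith
  have hKsub : closedBall x s ⊆ W ∩ D := (closedBall_subset_ball hsr').trans hsub
  refine Metric.mem_nhds_iff.2 ⟨c * s / 2, by positivity, fun y hy => ?_⟩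
  rw [mem_ball, dist_eq_norm] at hy
  have hcont : ContinuousOn (fun z => ‖f z - y‖ ^ 2) (closedBall x s) := by
    have : ContinuousOn f (closedBall x s) := fun z hz =>
      (hf z (hKsub hz).2).continuousAt.continuousWithinAt
    fun_prop
  obtain ⟨m, hm, hmin⟩ := (isCompact_closedBall x s).exists_isMinOn ⟨x, by simp [hs0.le]⟩ hcont
  have hmx : ‖f m - y‖ ^ 2 ≤ ‖f x - y‖ ^ 2 := hmin (by simp [hs0.le])
  have hmx' : ‖f m - y‖ ≤ ‖f x - y‖ := by
    exact (sq_le_sq₀ (norm_nonneg _) (norm_nonneg _)).1 hmx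
  have hmball : m ∈ ball x s := by
    by_contra hcon
    have hd : dist m x = s := le_antisymm hm (not_lt.1 hcon)
    have h1 := (hcr m (by linarith)).1
    rw [← dist_eq_norm m x, hd] at h1
    have h2 : ‖f m - f x‖ ≤ ‖f m - y‖ + ‖y - f x‖ := norm_sub_le_norm_sub_add_norm_sub _ _ _
    rw [norm_sub_rev (f x) y] at hmx'
    linarith
  have hloc : IsLocalMin (fun z => ‖f z - y‖ ^ 2) m :=
    hmin.isLocalMin (mem_of_superset (isOpen_ball.mem_nhds hmball) ball_subset_closedBall)
  have hder := ((hf m (hKsub hm).2).sub_const y).norm_sq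
  have hz := hloc.hasFDerivAt_eq_zero hder
  have hz2 := DFunLike.congr_fun hz ((A m).symm (f m - y))
  simp at hz2
  rw [← inner_sub_left, inner_self_eq_zero] at hz2
  exact ⟨m, (hKsub hm).1, sub_eq_zero.1 hz2⟩

lemma ldet_cover {D : Set E} (hD : IsOpen D) {f : E → E} {A : E → (E ≃L[ℝ] E)}
    (hf : ∀ x ∈ D, HasFDerivAt f (A x : E →L[ℝ] E) x) {K : Set E} (hK : IsCompact K) (hKD : K ⊆ D)
    {s : Set E} (hloc : ∀ p ∈ K, f p ∈ s → ∃ U ∈ 𝓝 p, U ⊆ K ∧ InjOn f U) :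
    IsCoveringMapOn (fun p : K => f p) s := by
  have : CompactSpace K := isCompact_iff_compactSpace.1 hK
  have hcf : Continuous (fun p : K => f p) := by
    rw [continuous_iff_continuousAt]
    intro p
    exact (hf p (hKD p.2)).continuousAt.comp continuous_subtype_val.continuousAt
  refine IsCoveringMapOn.of_isLocalHomeomorphOn hcf ?_
  rw [isLocalHomeomorphOn_iff_isOpenEmbedding_restrict]
  rintro ⟨p, hp⟩ hps
  obtain ⟨U, hU, hUK, hinj⟩ := hloc p hp hps
  obtain ⟨V, hVU, hV, hpV⟩ := _root_.mem_nhds_iff.1 hU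
  refine ⟨Subtype.val ⁻¹' V, continuous_subtype_val.continuousAt.preimage_mem_nhds (hV.mem_nhds hpV), ?_⟩
  refine IsOpenEmbedding.of_continuous_injective_isOpenMap ?_ ?_ ?_
  · exact hcf.comp continuous_subtype_val
  · rintro ⟨⟨a, ha⟩, ha'⟩ ⟨⟨b, hb⟩, hb'⟩ hab
    have : a = b := hinj (hVU ha') (hVU hb') hab
    subst this; rfl
  · rw [isOpenMap_iff_nhds_le]
    rintro ⟨⟨a, ha⟩, haV⟩ T hT
    rw [Filter.mem_map] at hT
    have haV : a ∈ V := haV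
    rw [nhds_subtype_eq_comap, mem_comap] at hT
    obtain ⟨T1, hT1, hT1'⟩ := hT
    rw [nhds_subtype_eq_comap, mem_comap] at hT1
    obtain ⟨T2, hT2, hT2'⟩ := hT1
    refine mem_of_superset (ldet_open hD hf (hKD ha) (inter_mem hT2 (hV.mem_nhds haV))) ?_
    rintro _ ⟨b, ⟨hb2, hbV⟩, rfl⟩
    have hbK : b ∈ K := hUK (hVU hbV)
    exact hT1' (a := ⟨⟨b, hbK⟩, hbV⟩) (hT2' (a := ⟨b, hbK⟩) hb2)

lemma ldet_key {f : E → E} {K : Set E} (hK : IsCompact K) (hfK : ContinuousOn f K)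
    {y : E} {ρ : ℝ} (hρ : 0 < ρ) (cov : IsCoveringMapOn (fun p : K => f p) (ball y ρ))
    {xs : E} (hxs : K ∈ 𝓝 xs) (huniq : ∀ x ∈ K, f x = f xs → x = xs)
    (hdist : dist y (f xs) = ρ) {A : E ≃L[ℝ] E} (hA : HasFDerivAt f (A : E →L[ℝ] E) xs)
    {x1 x2 : E} (h1 : x1 ∈ K) (h2 : x2 ∈ K) (hy1 : f x1 = y) (hy2 : f x2 = y) : x1 = x2 := by
  obtain ⟨c, hc, r, hr, hcr⟩ := ldet_approx hA
  obtain ⟨r', hr', hrK⟩ := Metric.mem_nhds_iff.1 hxs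
  set η := min r r' with hη
  have hη0 : 0 < η := lt_min hr hr'
  have hcfK : Continuous (fun p : K => f p) := continuousOn_iff_continuous_domRestrict.1 hfK
  -- properness near xs
  obtain ⟨δ, hδ, hprop⟩ : ∃ δ > 0, ∀ x ∈ K, dist (f x) (f xs) < δ → dist x xs < η := by
    have hcomp : IsCompact (f '' (K \ ball xs η)) :=
      (hK.diff isOpen_ball).image_of_continuousOn (hfK.mono sdiff_subset)
    have hn : f xs ∉ f '' (K \ ball xs η) := by
      rintro ⟨x, ⟨hx, hx'⟩, hfx⟩
      exact hx' (by rw [huniq x hx hfx]; exact mem_ball_self hη0)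
    obtain ⟨δ, hδ, hb⟩ := Metric.mem_nhds_iff.1 (hcomp.isClosed.isOpen_compl.mem_nhds hn)
    refine ⟨δ, hδ, fun x hx hd => ?_⟩
    by_contra hcon
    exact hb hd ⟨x, ⟨hx, hcon⟩, rfl⟩
  -- sections
  have : ContractibleSpace (ball y ρ) := contractibleSpace_ball hρ
  have : LocallyPathConnectedSpace (ball y ρ) := isOpen_ball.locallyPathConnectedSpace
  let ι : C(ball y ρ, E) := ⟨Subtype.val, continuous_subtype_val⟩
  have hyb : y ∈ ball y ρ := mem_ball_self hρ
  obtain ⟨σ1, ⟨hσ1, hfσ1⟩, -⟩ := cov.existsUnique_continuousMap_lifts ι (a₀ := ⟨y, hyb⟩)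
    (e₀ := ⟨x1, h1⟩) hy1 (fun a => a.2)
  obtain ⟨σ2, ⟨hσ2, hfσ2⟩, -⟩ := cov.existsUnique_continuousMap_lifts ι (a₀ := ⟨y, hyb⟩)
    (e₀ := ⟨x2, h2⟩) hy2 (fun a => a.2)
  have hf1 : ∀ z, f (σ1 z) = z := fun z => congrFun hfσ1 z
  have hf2 : ∀ z, f (σ2 z) = z := fun z => congrFun hfσ2 z
  -- point z
  obtain ⟨s, hs0, hs1, hsδ⟩ : ∃ s : ℝ, 0 < s ∧ s ≤ 1 ∧ s * ρ < δ := by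
    refine ⟨min 1 (δ / (2 * ρ)), by positivity, min_le_left _ _, ?_⟩
    calc min 1 (δ / (2 * ρ)) * ρ ≤ δ / (2 * ρ) * ρ := by gcongr; exact min_le_right _ _
      _ = δ / 2 := by field_simp
      _ < δ := by linarith
  rw [dist_eq_norm] at hdist
  set z : E := f xs + s • (y - f xs) with hz
  have hzy : ‖z - f xs‖ = s * ρ := by
    rw [hz, add_sub_cancel_left, norm_smul, hdist, Real.norm_of_nonneg hs0.le]
  have hzc : ‖z - y‖ = (1 - s) * ρ := by
    have : z - y = -((1 - s) • (y - f xs)) := by rw [hz]; module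
    rw [this, norm_neg, norm_smul, hdist, Real.norm_of_nonneg (by linarith)]
  have hzball : z ∈ ball y ρ := by
    rw [mem_ball, dist_eq_norm, hzc]; nlinarith
  set Z : ball y ρ := ⟨z, hzball⟩ with hZ
  have hsub : ∀ w, ‖w - z‖ < s * ρ → w ∈ ball y ρ := by
    intro w hw
    rw [mem_ball, dist_eq_norm]
    have := norm_sub_le_norm_sub_add_norm_sub w z y
    nlinarith
  have hnear : ∀ p : K, f p = z → ‖(p : E) - xs‖ < η ∧ ‖(p : E) - xs‖ ≤ s * ρ / c ∧
      ‖A ((p : E) - xs) - (z - f xs)‖ ≤ s * ρ / 4 := by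
    intro p hp
    have hd : dist (p : E) xs < η := hprop p p.2 (by rw [hp, dist_eq_norm, hzy]; exact hsδ)
    obtain ⟨e1, e2⟩ := hcr p (hd.trans_le (min_le_left _ _))
    rw [hp, hzy] at e1
    rw [hp] at e2
    refine ⟨by rwa [← dist_eq_norm], by rw [le_div_iff₀ hc]; linarith, ?_⟩
    rw [norm_sub_rev]
    linarith
  set u := σ1 Z with hu
  set v := σ2 Z with hv
  obtain ⟨u1, u2, u3⟩ := hnear u (hf1 Z)
  obtain ⟨v1, v2, v3⟩ := hnear v (hf2 Z)
  -- segment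
  have hseg : ∀ t : unitInterval, dist (AffineMap.lineMap (u : E) (v : E) (t : ℝ)) xs < η ∧
      f (AffineMap.lineMap (u : E) (v : E) (t : ℝ)) ∈ ball y ρ := by
    intro t
    obtain ⟨t, ht0, ht1⟩ := t
    simp only
    set w : E := AffineMap.lineMap (u : E) (v : E) t with hw
    have hw1 : w - xs = (1 - t) • ((u : E) - xs) + t • ((v : E) - xs) := by
      rw [hw, AffineMap.lineMap_apply_module]; module
    have conv : ∀ (a b : E) (C : ℝ), ‖a‖ ≤ C → ‖b‖ ≤ C → ‖(1 - t) • a + t • b‖ ≤ C := by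
      intro a b C ha hb
      have := convex_closedBall (0 : E) C (x := a) (by simpa using ha) (y := b) (by simpa using hb)
        (sub_nonneg.2 ht1) ht0 (by ring)
      simpa using this
    have hwd : dist w xs < η := by
      rw [dist_eq_norm, hw1]
      exact (conv _ _ (max ‖(u : E) - xs‖ ‖(v : E) - xs‖) (le_max_left _ _) (le_max_right _ _)).trans_lt
        (max_lt u1 v1)
    have hwn : ‖w - xs‖ ≤ s * ρ / c := by rw [hw1]; exact conv _ _ _ u2 v2
    have hAw : ‖A (w - xs) - (z - f xs)‖ ≤ s * ρ / 4 := by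
      have : A (w - xs) - (z - f xs) = (1 - t) • (A ((u : E) - xs) - (z - f xs))
          + t • (A ((v : E) - xs) - (z - f xs)) := by
        rw [hw1, map_add, map_smul, map_smul]; module
      rw [this]; exact conv _ _ _ u3 v3
    refine ⟨hwd, hsub _ ?_⟩
    have e2 := (hcr w (hwd.trans_le (min_le_left _ _))).2
    have e3 : c / 4 * ‖w - xs‖ ≤ s * ρ / 4 := by
      calc c / 4 * ‖w - xs‖ ≤ c / 4 * (s * ρ / c) := by gcongr
        _ = s * ρ / 4 := by field_simp
    have e4 : f w - z = (f w - f xs - A (w - xs)) + (A (w - xs) - (z - f xs)) := by abel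
    rw [e4]
    have := norm_add_le (f w - f xs - A (w - xs)) (A (w - xs) - (z - f xs))
    have : 0 < s * ρ := by positivity
    linarith
  let γ : C(unitInterval, K) :=
    ⟨fun t => ⟨AffineMap.lineMap (u : E) (v : E) (t : ℝ),
      hrK (lt_of_lt_of_le (hseg t).1 (min_le_right _ _))⟩, by
        refine Continuous.subtype_mk ?_ _
        exact AffineMap.lineMap_continuous.comp continuous_subtype_val⟩
  let φ : C(unitInterval, ball y ρ) :=
    ⟨fun t => ⟨f (γ t), (hseg t).2⟩, by
      refine Continuous.subtype_mk ?_ _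
      exact hcfK.comp γ.continuous⟩
  have hγ0 : γ 0 = u := Subtype.ext (by simp [γ])
  have hγ1 : γ 1 = v := Subtype.ext (by simp [γ])
  have hφ0 : φ 0 = Z := Subtype.ext (by change f (γ 0) = z; rw [hγ0]; exact hf1 Z)
  have hφ1 : φ 1 = Z := Subtype.ext (by change f (γ 1) = z; rw [hγ1]; exact hf2 Z)
  have huv : u = v := by
    have hm : ∀ t, σ1 (φ t) ∈ (fun p : K => f p) ⁻¹' ball y ρ := by
      intro t
      change f (σ1 (φ t)) ∈ ball y ρ
      rw [hf1]
      exact (φ t).2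
    have hcov := cov.isCoveringMap_restrictPreimage
    have hg2 : Continuous fun t => σ1 (φ t) := σ1.continuous.comp φ.continuous
    have := hcov.eq_of_comp_eq (A := unitInterval)
      (g₁ := fun t => ⟨γ t, (hseg t).2⟩)
      (g₂ := fun t => ⟨σ1 (φ t), hm t⟩)
      (γ.continuous.subtype_mk fun t => (hseg t).2) (hg2.subtype_mk hm)
      (by
        funext t
        refine Subtype.ext ?_
        change f (γ t) = f (σ1 (φ t))
        rw [hf1]
        rfl) 0 (by
        refine Subtype.ext ?_
        change γ 0 = σ1 (φ 0)
        rw [hγ0, hφ0])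
    have h1 : γ 1 = σ1 (φ 1) := congrArg Subtype.val (congrFun this 1)
    rw [hγ1, hφ1] at h1
    exact h1.symm
  have hex := cov.existsUnique_continuousMap_lifts ι (a₀ := Z) (e₀ := u) (hf1 Z) (fun a => a.2)
  have hσ := hex.unique (y₁ := σ1) (y₂ := σ2) ⟨rfl, hfσ1⟩ ⟨huv.symm, hfσ2⟩
  rw [hσ, hσ2] at hσ1
  exact (congrArg Subtype.val hσ1).symm

/-- Local injectivity, by a Baire category argument on the set of bad points. -/
lemma ldet_inj {D : Set E} (hD : IsOpen D) {f : E → E} {A : E → (E ≃L[ℝ] E)}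
    (hf : ∀ x ∈ D, HasFDerivAt f (A x : E →L[ℝ] E) x) {x : E} (hx : x ∈ D) :
    ∃ U ∈ 𝓝 x, InjOn f U := by
  by_contra hbad
  set G : Set E := {x | ∃ U ∈ 𝓝 x, InjOn f U} with hG
  have hGo : IsOpen G := by
    rw [isOpen_iff_mem_nhds]
    rintro p ⟨U, hU, hinj⟩
    filter_upwards [eventually_mem_nhds_iff.2 hU] with q hq
    exact ⟨U, hq, hinj⟩
  set B : Set E := D ∩ Gᶜ with hB
  have hBlc : IsLocallyClosed B := hD.isLocallyClosed.inter hGo.isClosed_compl.isLocallyClosed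
  have : LocallyCompactSpace B := hBlc.locallyCompactSpace
  have : Nonempty B := ⟨⟨x, hx, hbad⟩⟩
  let F : ℕ → Set B := fun m => {p | ∀ w ∈ D, dist w p < 1 / ((m : ℝ) + 1) →
    1 / ((m : ℝ) + 1) * ‖w - p‖ ≤ ‖f w - f p‖}
  have hcfB : Continuous (fun p : B => f p) := by
    rw [continuous_iff_continuousAt]
    intro p
    exact (hf p p.2.1).continuousAt.comp continuous_subtype_val.continuousAt
  have hFc : ∀ m, IsClosed (F m) := by
    intro m
    simp only [F, ofPred_forall]
    refine isClosed_iInter fun w => isClosed_iInter fun _ => ?_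
    refine isClosed_imp ?_ ?_
    · exact isOpen_lt (continuous_const.dist continuous_subtype_val) continuous_const
    · exact isClosed_le (continuous_const.mul (continuous_const.sub continuous_subtype_val).norm)
        (continuous_const.sub hcfB).norm
  have hFU : ⋃ m, F m = univ := by
    refine eq_univ_of_forall fun p => ?_
    obtain ⟨c, hc, r, hr, hcr⟩ := ldet_approx (hf p p.2.1)
    obtain ⟨m, hm⟩ := exists_nat_one_div_lt (lt_min hc hr)
    refine mem_iUnion.2 ⟨m, fun w _ hw => ?_⟩
    have := (hcr w (hw.trans (hm.trans_le (min_le_right _ _)))).1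
    refine le_trans ?_ this
    gcongr
    exact (hm.trans_le (min_le_left _ _)).le
  obtain ⟨m, ⟨p, hp⟩⟩ := nonempty_interior_of_iUnion_of_closed hFc hFU
  rw [mem_interior_iff_mem_nhds, nhds_subtype_eq_comap, mem_comap] at hp
  obtain ⟨T, hT, hTF⟩ := hp
  obtain ⟨x0, hx0D, hx0G⟩ := p
  simp only at hT
  obtain ⟨c, hc, r0, hr0, hcr⟩ := ldet_approx (hf x0 hx0D)
  obtain ⟨r1, hr1, hr1s⟩ := Metric.mem_nhds_iff.1 (inter_mem hT (hD.mem_nhds hx0D))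
  set M : ℝ := 1 / ((m : ℝ) + 1) with hM
  have hM0 : 0 < M := by positivity
  set r := min (min r0 r1) M / 4 with hr
  have hrp : 0 < r := by positivity
  have hle1 : min (min r0 r1) M ≤ r0 := (min_le_left _ _).trans (min_le_left _ _)
  have hle2 : min (min r0 r1) M ≤ r1 := (min_le_left _ _).trans (min_le_right _ _)
  have hle3 : min (min r0 r1) M ≤ M := min_le_right _ _
  set K := closedBall x0 r with hKdef
  have hKc : IsCompact K := isCompact_closedBall x0 r
  have hKTD : K ⊆ T ∩ D := (closedBall_subset_ball (by linarith)).trans hr1s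
  have hKD : K ⊆ D := fun a ha => (hKTD ha).2
  have hfK : ContinuousOn f K := fun a ha => (hf a (hKD ha)).continuousAt.continuousWithinAt
  -- bad points in K have unique preimages
  have huniq : ∀ b ∈ K, b ∉ G → ∀ a ∈ K, f a = f b → a = b := by
    intro b hb hbG a ha hab
    have h1 : (⟨b, hKD hb, hbG⟩ : B) ∈ F m := hTF (hKTD hb).1
    have h2 := h1 a (hKD ha) (by
      have e1 : dist a x0 ≤ r := ha
      have e2 : dist b x0 ≤ r := hb
      have := dist_triangle_right a b x0
      change dist a b < M
      linarith)
    simp only [hab, sub_self, norm_zero] at h2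
    have h3 : ‖a - b‖ = 0 := le_antisymm (by
      by_contra hcon
      have := mul_pos hM0 (not_le.1 hcon)
      linarith) (norm_nonneg _)
    exact sub_eq_zero.1 (norm_eq_zero.1 h3)
  set δ := c * r with hδ
  have hδ0 : 0 < δ := by positivity
  have hbdry : ∀ a ∈ K, dist (f a) (f x0) < δ → a ∈ ball x0 r := by
    intro a ha hd
    by_contra hcon
    have hda : dist a x0 = r := le_antisymm ha (not_lt.1 hcon)
    have := (hcr a (by linarith)).1
    rw [← dist_eq_norm, ← dist_eq_norm, hda] at this
    linarith
  have hx0K : x0 ∈ K := mem_closedBall_self hrp.le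
  refine hx0G ⟨K ∩ f ⁻¹' ball (f x0) (δ / 2), inter_mem (closedBall_mem_nhds _ hrp)
    ((hf x0 hx0D).continuousAt.preimage_mem_nhds (ball_mem_nhds _ (by positivity))), ?_⟩
  rintro a ⟨haK, ha⟩ b ⟨hbK, hb⟩ hab
  set y := f b with hy
  have hyd : dist y (f x0) < δ / 2 := hb
  have hFc' : IsCompact (f '' (K ∩ Gᶜ)) :=
    (hKc.inter_right hGo.isClosed_compl).image_of_continuousOn (hfK.mono inter_subset_left)
  obtain ⟨ys, ⟨xs, ⟨hxsK, hxsG⟩, rfl⟩, hys⟩ := hFc'.exists_infDist_eq_dist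
    ⟨f x0, x0, ⟨hx0K, hx0G⟩, rfl⟩ y
  have hmin : ∀ q ∈ K, q ∉ G → dist y (f xs) ≤ dist y (f q) := by
    intro q hq hqG
    rw [← hys]
    exact infDist_le_dist_of_mem ⟨q, ⟨hq, hqG⟩, rfl⟩
  have hρlt : dist y (f xs) < δ / 2 := (hmin x0 hx0K hx0G).trans_lt hyd
  rcases eq_or_lt_of_le (dist_nonneg (x := y) (y := f xs)) with h0 | hρ
  · have h0' : y = f xs := dist_eq_zero.1 h0.symm
    rw [huniq xs hxsK hxsG a haK (hab.trans h0'), huniq xs hxsK hxsG b hbK h0']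
  · have hxsball : xs ∈ ball x0 r := by
      refine hbdry xs hxsK ?_
      have := dist_triangle_left (f xs) (f x0) y
      linarith
    refine ldet_key hKc hfK hρ (ldet_cover hD hf hKc hKD ?_)
      (mem_of_superset (isOpen_ball.mem_nhds hxsball) ball_subset_closedBall)
      (huniq xs hxsK hxsG) rfl (hf xs (hKD hxsK)) haK hbK hab rfl
    intro q hq hqs
    have hqs : dist (f q) y < dist y (f xs) := hqs
    have hqG : q ∈ G := by
      by_contra hqG
      have := hmin q hq hqG
      rw [dist_comm y (f q)] at this
      linarith
    have hqball : q ∈ ball x0 r := by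
      refine hbdry q hq ?_
      have := dist_triangle (f q) y (f x0)
      linarith
    obtain ⟨U, hU, hinj⟩ := hqG
    exact ⟨U ∩ ball x0 r, inter_mem hU (isOpen_ball.mem_nhds hqball),
      inter_subset_right.trans ball_subset_closedBall, hinj.mono inter_subset_left⟩

end Helpers

/-- Lemma 1 of the paper: a Fréchet differentiable map on an open set `D ⊆ ℝⁿ`
with `det f'(x) ≠ 0` on `D` is a local diffeomorphism: every `x₀ ∈ D` has an
open neighborhood `U ⊆ D` on which `f` is injective, `f '' U` is open, and the
inverse map `f '' U → U` is differentiable. -/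
theorem local_diffeomorphism_of_det_ne_zero
    (n : ℕ)
    (D : Set (EuclideanSpace ℝ (Fin n)))
    (hD : IsOpen D)
    (f : EuclideanSpace ℝ (Fin n) → EuclideanSpace ℝ (Fin n))
    (f' : EuclideanSpace ℝ (Fin n) →
      (EuclideanSpace ℝ (Fin n) →L[ℝ] EuclideanSpace ℝ (Fin n)))
    (hf : ∀ x ∈ D, HasFDerivAt f (f' x) x)
    (hdet : ∀ x ∈ D, LinearMap.det ((f' x).toLinearMap) ≠ 0) :
    ∀ x₀ ∈ D, ∃ U : Set (EuclideanSpace ℝ (Fin n)),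
      IsOpen U ∧ x₀ ∈ U ∧ U ⊆ D ∧ Set.InjOn f U ∧ IsOpen (f '' U) ∧
      ∃ g : EuclideanSpace ℝ (Fin n) → EuclideanSpace ℝ (Fin n),
        (∀ x ∈ U, g (f x) = x) ∧ (∀ y ∈ f '' U, g y ∈ U) ∧
        DifferentiableOn ℝ g (f '' U) := by
  intro x₀ hx₀
  classical
  let A : EuclideanSpace ℝ (Fin n) → (EuclideanSpace ℝ (Fin n) ≃L[ℝ] EuclideanSpace ℝ (Fin n)) :=
    fun x => if h : LinearMap.det ((f' x).toLinearMap) ≠ 0 then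
      (f' x).toContinuousLinearEquivOfDetNeZero h else ContinuousLinearEquiv.refl ℝ _
  have hfA : ∀ x ∈ D, HasFDerivAt f
      (A x : EuclideanSpace ℝ (Fin n) →L[ℝ] EuclideanSpace ℝ (Fin n)) x := by
    intro x hx
    have : (A x : EuclideanSpace ℝ (Fin n) →L[ℝ] EuclideanSpace ℝ (Fin n)) = f' x := by
      simp only [A, dif_pos (hdet x hx)]
      exact ContinuousLinearMap.coe_toContinuousLinearEquivOfDetNeZero _ _
    rw [this]
    exact hf x hx
  obtain ⟨U', hU', hinj'⟩ := ldet_inj hD hfA hx₀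
  obtain ⟨U, hUs, hU, hxU⟩ := _root_.mem_nhds_iff.1 (inter_mem hU' (hD.mem_nhds hx₀))
  have hinj : InjOn f U := hinj'.mono fun a ha => (hUs ha).1
  have hUD : U ⊆ D := fun a ha => (hUs ha).2
  have hopen : IsOpen (f '' U) := by
    rw [isOpen_iff_mem_nhds]
    rintro _ ⟨a, ha, rfl⟩
    exact ldet_open hD hfA (hUD ha) (hU.mem_nhds ha)
  have hleft : ∀ x ∈ U, Function.invFunOn f U (f x) = x := fun x hx => hinj.leftInvOn_invFunOn hx
  refine ⟨U, hU, hxU, hUD, hinj, hopen, Function.invFunOn f U, hleft, ?_, ?_⟩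
  · rintro _ ⟨a, ha, rfl⟩
    rw [hleft a ha]
    exact ha
  · rintro _ ⟨a, ha, rfl⟩
    refine DifferentiableAt.differentiableWithinAt ?_
    have hc : ContinuousAt (Function.invFunOn f U) (f a) := by
      intro W hW
      rw [hleft a ha] at hW
      rw [Filter.mem_map]
      refine mem_of_superset (ldet_open hD hfA (hUD ha) (inter_mem hW (hU.mem_nhds ha))) ?_
      rintro _ ⟨b, ⟨hbW, hbU⟩, rfl⟩
      change Function.invFunOn f U (f b) ∈ W
      rw [hleft b hbU]
      exact hbW
    refine (HasFDerivAt.of_local_left_inverse (f := f) (f' := A a) hc ?_ ?_).differentiableAt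
    · rw [hleft a ha]
      exact hfA a (hUD ha)
    · filter_upwards [hopen.mem_nhds ⟨a, ha, rfl⟩] with y hy
      obtain ⟨b, hb, rfl⟩ := hy
      rw [hleft b hb]
end

section
/- Let f : ℝⁿ → ℝⁿ be strictly differentiable at every point, let η : ℝⁿ → [0,∞) be a C¹ functional, and assume: (c1) η(x) = 0 if and only if x = 0, and η'(x) = 0 if and only if x = 0; (c2) for every y ∈ ℝⁿ the functional φ(x) = η(f(x) − y) is coercive; (c3) det f'(x) ≠ 0 for every x ∈ ℝⁿ; (c4) there exist positive constants c, α, M such that η(x) ≥ c‖x‖^α whenever ‖x‖ ≤ M. Then f is a global diffeomorphism of ℝⁿ onto ℝⁿ: f is bijective and both f and its inverse f⁻¹ are differentiable at every point. -/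
open Filter

/-- Theorem 4 of the paper: a strictly differentiable `f : ℝⁿ → ℝⁿ` is a global
diffeomorphism provided there is a nonnegative `C¹` functional `η` with
(c1) `η x = 0 ↔ x = 0` and `η' x = 0 ↔ x = 0`, (c2) `x ↦ η (f x − y)` coercive
for every `y`, (c3) `det f'(x) ≠ 0` everywhere, and (c4) `η x ≥ c‖x‖^α` for
`‖x‖ ≤ M`, with `c, α, M > 0`.  Here `ℝⁿ` carries an arbitrary norm. -/
theorem global_diffeomorphism_of_strict_eta
    {E : Type*} [NormedAddCommGroup E] [NormedSpace ℝ E] [FiniteDimensional ℝ E]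
    (f : E → E) (f' : E → (E →L[ℝ] E))
    (hf : ∀ x, HasStrictFDerivAt f (f' x) x)
    (η : E → ℝ)
    (hη0 : ∀ x, 0 ≤ η x)
    (hηC1 : ContDiff ℝ 1 η)
    (hc1 : ∀ x, (η x = 0 ↔ x = 0) ∧ (fderiv ℝ η x = 0 ↔ x = 0))
    (hc2 : ∀ y : E, Tendsto (fun x => η (f x - y))
      (Filter.comap (fun x => ‖x‖) atTop) atTop)
    (hc3 : ∀ x, LinearMap.det ((f' x).toLinearMap) ≠ 0)
    (hc4 : ∃ c α M : ℝ, 0 < c ∧ 0 < α ∧ 0 < M ∧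
      ∀ x : E, ‖x‖ ≤ M → c * ‖x‖ ^ α ≤ η x) :
    Function.Bijective f ∧ Differentiable ℝ f ∧
      Differentiable ℝ (Function.invFun f) := by
  have hfc : Continuous f :=
    continuous_iff_continuousAt.2 fun x => (hf x).hasFDerivAt.continuousAt
  have hdet : ∀ x, (f' x).det ≠ 0 := hc3
  let A : E → (E ≃L[ℝ] E) := fun x => (f' x).toContinuousLinearEquivOfDetNeZero (hdet x)
  have hA : ∀ x, HasStrictFDerivAt f (A x : E →L[ℝ] E) x := by
    intro x
    simpa [A] using hf x
  have hloc : IsLocalHomeomorph f := by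
    apply IsLocalHomeomorph.mk
    intro x
    exact ⟨(hA x).toOpenPartialHomeomorph f, (hA x).mem_toOpenPartialHomeomorph_source,
      fun _ _ => rfl⟩
  have hproper : IsProperMap f := by
    rw [isProperMap_iff_isCompact_preimage]
    refine ⟨hfc, fun K hK => ?_⟩
    obtain ⟨B, hB⟩ := (hK.image hηC1.continuous).bddAbove
    have h2 := (hc2 0).eventually (eventually_gt_atTop B)
    rw [eventually_comap] at h2
    obtain ⟨R, hR⟩ := eventually_atTop.1 h2
    refine Metric.isCompact_of_isClosed_isBounded (hK.isClosed.preimage hfc) ?_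
    refine (Metric.isBounded_closedBall (x := (0 : E)) (r := R)).subset fun x hx => ?_
    rw [mem_closedBall_zero_iff]
    by_contra hlt
    have h3 := hR ‖x‖ (not_le.1 hlt).le x rfl
    have h4 : η (f x) ≤ B := hB ⟨f x, hx, rfl⟩
    simp only [sub_zero] at h3
    linarith
  have hcov : IsCoveringMap f := by
    rw [isCoveringMap_iff_isCoveringMapOn_univ]
    refine hproper.isClosedMap.isCoveringMapOn_of_isLocalHomeomorphOn (fun y _ => ?_)
      (hloc.isLocalHomeomorphOn.mono (Set.subset_univ _))
    refine (hproper.isCompact_preimage isCompact_singleton).finite ?_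
    refine IsDiscrete.of_openPartialHomeomorph (x := y) f subset_rfl fun e _ => ?_
    exact ⟨(hA e).toOpenPartialHomeomorph f, (hA e).mem_toOpenPartialHomeomorph_source, rfl⟩
  have hsurj : Function.Surjective f := by
    rw [← Set.range_eq_univ]
    exact IsClopen.eq_univ ⟨hproper.isClosed_range, hloc.isOpenMap.isOpen_range⟩
      (Set.range_nonempty f)
  have hinj : Function.Injective f := by
    intro a b hab
    obtain ⟨F, ⟨hFa, hF⟩, -⟩ :=
      hcov.existsUnique_continuousMap_lifts (ContinuousMap.id E) (f a) a rfl
    have h := hcov.eq_of_comp_eq (g₁ := F ∘ f) (g₂ := id) (F.continuous.comp hfc)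
      continuous_id (by funext x; exact congrFun hF (f x)) a hFa
    have hb : F (f b) = b := congrFun h b
    rw [← hb, ← hab, hFa]
  refine ⟨⟨hinj, hsurj⟩, fun x => (hf x).hasFDerivAt.differentiableAt, fun y => ?_⟩
  obtain ⟨x, rfl⟩ := hsurj y
  exact ((hA x).to_local_left_inverse
    (Eventually.of_forall (Function.leftInverse_invFun hinj))).hasFDerivAt.differentiableAt
end

section
/- Let f : ℝⁿ → ℝⁿ be strictly differentiable at every point and let η : ℝⁿ → [0,∞) be a C¹ functional such that η(x) = 0 iff x = 0 and η'(x) = 0 iff x = 0. Assume that for every y ∈ ℝⁿ the functional x ↦ η(f(x) − y) is coercive and that det f'(x) ≠ 0 for every x ∈ ℝⁿ. Then f is surjective: for every y ∈ ℝⁿ there exists x̄ with f(x̄) = y. -/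
open Filter

/-- Surjectivity part of Theorem 4 of the paper: under (c1)–(c3), `f` is onto. -/
theorem surjective_of_strict_eta
    {E : Type*} [NormedAddCommGroup E] [NormedSpace ℝ E] [FiniteDimensional ℝ E]
    (f : E → E) (f' : E → (E →L[ℝ] E))
    (hf : ∀ x, HasStrictFDerivAt f (f' x) x)
    (η : E → ℝ)
    (hη0 : ∀ x, 0 ≤ η x)
    (hηC1 : ContDiff ℝ 1 η)
    (hc1 : ∀ x, (η x = 0 ↔ x = 0) ∧ (fderiv ℝ η x = 0 ↔ x = 0))
    (hc2 : ∀ y : E, Tendsto (fun x => η (f x - y))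
      (Filter.comap (fun x => ‖x‖) atTop) atTop)
    (hc3 : ∀ x, LinearMap.det ((f' x).toLinearMap) ≠ 0) :
    ∀ y : E, ∃ xbar : E, f xbar = y := by
  intro y
  have := FiniteDimensional.proper ℝ E
  have hfc : Continuous f := continuous_iff_continuousAt.2 fun x => (hf x).continuousAt
  have hcont : Continuous (fun x => η (f x - y)) :=
    hηC1.continuous.comp (hfc.sub continuous_const)
  have hco := hc2 y
  rw [comap_norm_atTop, Metric.cobounded_eq_cocompact] at hco
  obtain ⟨x, hx⟩ := hcont.exists_forall_le hco
  refine ⟨x, ?_⟩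
  have hmin : IsLocalMin (fun x => η (f x - y)) x := Filter.Eventually.of_forall hx
  have hη : HasFDerivAt η (fderiv ℝ η (f x - y)) (f x - y) :=
    (hηC1.differentiable one_ne_zero _).hasFDerivAt
  have hd : HasFDerivAt (fun x => η (f x - y)) ((fderiv ℝ η (f x - y)).comp (f' x)) x :=
    HasFDerivAt.comp x hη ((hf x).hasFDerivAt.sub_const y)
  have h0 := hmin.hasFDerivAt_eq_zero hd
  have hsurj : Function.Surjective (f' x) :=
    (LinearMap.equivOfDetNeZero _ (hc3 x)).surjective
  have hz : fderiv ℝ η (f x - y) = 0 := by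
    ext v
    obtain ⟨u, rfl⟩ := hsurj v
    exact DFunLike.congr_fun h0 u
  exact sub_eq_zero.1 ((hc1 _).2.1 hz)
end

section
/- Let f : ℝⁿ → ℝⁿ be strictly differentiable at every point, let η : ℝⁿ → [0,∞) be a C¹ functional with (η(x) = 0 iff x = 0) and (η'(x) = 0 iff x = 0), assume that for every y ∈ ℝⁿ the functional x ↦ η(f(x) − y) is coercive, that det f'(x) ≠ 0 for every x ∈ ℝⁿ, and that there exist positive constants c, α, M such that η(x) ≥ c‖x‖^α whenever ‖x‖ ≤ M. Then f is injective: if f(x₁) = f(x₂) then x₁ = x₂. -/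
open Filter

/-- Injectivity part of Theorem 4 of the paper: under (c1)–(c4), `f` is
one-to-one.  Here `ℝⁿ` carries an arbitrary norm. -/
theorem injective_of_strict_eta
    {E : Type*} [NormedAddCommGroup E] [NormedSpace ℝ E] [FiniteDimensional ℝ E]
    (f : E → E) (f' : E → (E →L[ℝ] E))
    (hf : ∀ x, HasStrictFDerivAt f (f' x) x)
    (η : E → ℝ)
    (hη0 : ∀ x, 0 ≤ η x)
    (hηC1 : ContDiff ℝ 1 η)
    (hc1 : ∀ x, (η x = 0 ↔ x = 0) ∧ (fderiv ℝ η x = 0 ↔ x = 0))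
    (hc2 : ∀ y : E, Tendsto (fun x => η (f x - y))
      (Filter.comap (fun x => ‖x‖) atTop) atTop)
    (hc3 : ∀ x, LinearMap.det ((f' x).toLinearMap) ≠ 0)
    (hc4 : ∃ c α M : ℝ, 0 < c ∧ 0 < α ∧ 0 < M ∧
      ∀ x : E, ‖x‖ ≤ M → c * ‖x‖ ^ α ≤ η x) :
    ∀ x₁ x₂ : E, f x₁ = f x₂ → x₁ = x₂ := by
  classical
  have hcont : Continuous f := continuous_iff_continuousAt.2 fun x => (hf x).continuousAt
  -- `f` is a local homeomorphism by the inverse function theorem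
  have hloc : ∀ x, ∃ φ : OpenPartialHomeomorph E E, x ∈ φ.source ∧ φ = f := by
    intro x
    let B := (f' x).toContinuousLinearEquivOfDetNeZero (hc3 x)
    have hB : HasStrictFDerivAt f (B : E →L[ℝ] E) x := by
      rw [ContinuousLinearMap.coe_toContinuousLinearEquivOfDetNeZero]
      exact hf x
    exact ⟨hB.toOpenPartialHomeomorph f, hB.mem_toOpenPartialHomeomorph_source,
      hB.toOpenPartialHomeomorph_coe⟩
  have : ProperSpace E := FiniteDimensional.proper ℝ E
  -- `f` is proper since `η ∘ f` is coercive and `η` is continuous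
  have hprop : IsProperMap f := by
    refine isProperMap_iff_tendsto_cocompact.mpr ⟨hcont, ?_⟩
    rw [(hasBasis_cocompact).tendsto_right_iff]
    intro K hK
    obtain ⟨C, hC⟩ := (hK.image hηC1.continuous).bddAbove
    have h0 := hc2 0
    rw [comap_norm_atTop, Metric.cobounded_eq_cocompact] at h0
    filter_upwards [h0.eventually_gt_atTop C] with x hx hxK
    have := hC (Set.mem_image_of_mem η hxK)
    simp only [sub_zero] at hx
    linarith
  have hcov : IsCoveringMap f := fun y =>
    hprop.isClosedMap.isEvenlyCovered_of_openPartialHomeomorph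
      ((hprop.isCompact_preimage isCompact_singleton).finite
        (.of_openPartialHomeomorph f subset_rfl fun e _ => hloc e)) (fun e _ => hloc e)
  intro x₁ x₂ h
  obtain ⟨F, ⟨hF1, hF2⟩, -⟩ :=
    hcov.existsUnique_continuousMap_lifts (ContinuousMap.id E) (f x₁) x₁ rfl
  have hid : (F ∘ f) = id := by
    refine hcov.eq_of_comp_eq (F.continuous.comp hcont) continuous_id ?_ x₁ hF1
    funext x
    exact congrFun hF2 (f x)
  have e1 := congrFun hid x₁
  have e2 := congrFun hid x₂
  simp only [Function.comp_apply, id] at e1 e2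
  rw [← e1, ← e2, h]
end
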